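/- Let α>0, β>0, a>0, q>1 with β/(q-1)-α>0, θ>0, μ∈ℝ. The generalized q-logistic density f(y) = C e^{α(y-μ)/θ}[1+a(q-1)e^{(y-μ)/θ}]^{-β/(q-1)} is log-concave on ℝ, i.e., y ↦ ln f(y) is a concave function on ℝ. -/

import Mathlib

open Real

/-- The softplus-type function `x ↦ log (1 + c * exp x)` is convex for `0 < c`. -/
theorem convexOn_log_one_add_mul_exp {c : ℝ} (hc : 0 < c) :
    ConvexOn ℝ Set.univ (fun x : ℝ => Real.log (1 + c * Real.exp x)) := by
  have hd (x : ℝ) : HasDerivAt (fun x : ℝ => Real.log (1 + c * Real.exp x))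
      (c * Real.exp x / (1 + c * Real.exp x)) x :=
    (((Real.hasDerivAt_exp x).const_mul c).const_add 1).log (by positivity)
  refine Monotone.convexOn_univ_of_deriv (fun x => (hd x).differentiableAt) fun x y hxy => ?_
  rw [(hd x).deriv, (hd y).deriv, div_le_div_iff₀ (by positivity) (by positivity)]
  have h : c * Real.exp x ≤ c * Real.exp y := by gcongr
  linarith

/-- The generalized q-logistic density is log-concave on ℝ. -/
theorem GqL_density_log_concave
    (α β a q θ μ : ℝ) (hα : 0 < α) (hβ : 0 < β) (ha : 0 < a) (hq : 1 < q)
    (hβα : 0 < β / (q - 1) - α) (hθ : 0 < θ) :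
    ConcaveOn ℝ Set.univ (fun y : ℝ => Real.log
      (((a * (q - 1)) ^ α * Real.Gamma (β / (q - 1)) /
          (θ * Real.Gamma α * Real.Gamma (β / (q - 1) - α))) *
        (Real.exp (α * (y - μ) / θ) *
          (1 + a * (q - 1) * Real.exp ((y - μ) / θ)) ^ (-(β / (q - 1)))))) := by
  have hq' : 0 < q - 1 := sub_pos.mpr hq
  have hb : 0 < β / (q - 1) := div_pos hβ hq'
  have hc : 0 < a * (q - 1) := mul_pos ha hq'
  have hC : 0 < (a * (q - 1)) ^ α * Real.Gamma (β / (q - 1)) /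
      (θ * Real.Gamma α * Real.Gamma (β / (q - 1) - α)) := by
    have := Real.Gamma_pos_of_pos hb
    have := Real.Gamma_pos_of_pos hα
    have := Real.Gamma_pos_of_pos hβα
    positivity
  generalize (a * (q - 1)) ^ α * Real.Gamma (β / (q - 1)) /
      (θ * Real.Gamma α * Real.Gamma (β / (q - 1) - α)) = C at hC ⊢
  generalize β / (q - 1) = b at hb ⊢
  generalize a * (q - 1) = c at hc ⊢
  have hlog (y : ℝ) : Real.log (C * (Real.exp (α * (y - μ) / θ) *
      (1 + c * Real.exp ((y - μ) / θ)) ^ (-b))) =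
      Real.log C + (α * (y - μ) / θ - b * Real.log (1 + c * Real.exp ((y - μ) / θ))) := by
    have h : 0 < 1 + c * Real.exp ((y - μ) / θ) := by positivity
    rw [Real.log_mul hC.ne' (by positivity), Real.log_mul (by positivity) (by positivity),
      Real.log_exp, Real.log_rpow h]
    ring
  simp only [hlog]
  refine ⟨convex_univ, fun x _ y _ s t hs ht hst => ?_⟩
  have hconv := (convexOn_log_one_add_mul_exp hc).2 (Set.mem_univ ((x - μ) / θ))
    (Set.mem_univ ((y - μ) / θ)) hs ht hst
  obtain rfl : t = 1 - s := by linarith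
  simp only [smul_eq_mul] at hconv ⊢
  have harg : (s * x + (1 - s) * y - μ) / θ =
      s * ((x - μ) / θ) + (1 - s) * ((y - μ) / θ) := by ring
  rw [harg]
  have hmul := mul_le_mul_of_nonneg_left hconv hb.le
  have hlin : α * (s * x + (1 - s) * y - μ) / θ =
      s * (α * (x - μ) / θ) + (1 - s) * (α * (y - μ) / θ) := by ring
  rw [hlin]
  linarith
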